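/- Two representations φ, ψ ∈ E(d) of the equioriented quiver Δ_n lie in the same G_d-orbit if and only if for all 1 ≤ i ≤ j ≤ n−1 one has rank(φ_j ∘ φ_{j−1} ∘ ⋯ ∘ φ_i) = rank(ψ_j ∘ ψ_{j−1} ∘ ⋯ ∘ ψ_i). (This realizes the parametrization of G_d-orbits in E(d) by multisegments.) -/

import Mathlib

open Module LinearMap Finset

/-- The composition `φ_{i+t-1} ∘ ⋯ ∘ φ_{i+1} ∘ φ_i` of `t` consecutive structure
maps of a representation of an equioriented quiver of type `A`, starting at
vertex `i` (for `t = 0` it is the identity of the vertex space `V i`). -/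
def comps {k : Type*} [Field k] {V : ℕ → Type*}
    [∀ i, AddCommGroup (V i)] [∀ i, Module k (V i)]
    (φ : ∀ i : ℕ, V i →ₗ[k] V (i + 1)) (i : ℕ) : ∀ t : ℕ, V i →ₗ[k] V (i + t)
  | 0 => LinearMap.id
  | t + 1 => (φ (i + t)).comp (comps φ i t)

/-- Two points `φ, ψ` of the representation space
`E(d) = ⊕ᵢ Hom(k^{dᵢ}, k^{dᵢ₊₁})` of the equioriented quiver of type `A`
lie in the same orbit of `G_d = ∏ᵢ GL_{dᵢ}(k)`, acting by
`(g·φ)ᵢ = gᵢ₊₁ ∘ φᵢ ∘ gᵢ⁻¹`. -/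
def sameOrbitA (k : Type*) [Field k] (d : ℕ → ℕ)
    (φ ψ : ∀ i : ℕ, (Fin (d i) → k) →ₗ[k] (Fin (d (i + 1)) → k)) : Prop :=
  ∃ g : ∀ i : ℕ, (Fin (d i) → k) ≃ₗ[k] (Fin (d i) → k),
    ∀ i, ψ i = (g (i + 1)).toLinearMap ∘ₗ φ i ∘ₗ ((g i).symm).toLinearMap
section Extension

variable {k A V W U : Type*} [Field k] [AddCommGroup A] [Module k A]
  [AddCommGroup V] [Module k V] [AddCommGroup W] [Module k W] [AddCommGroup U] [Module k U]

/-- Over a field, a linear map vanishing on the kernel of `p` factors through `p`. -/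
theorem exists_factor_of_ker_le_ker (p : A →ₗ[k] V) (f : A →ₗ[k] W)
    (h : ker p ≤ ker f) : ∃ e : V →ₗ[k] W, ∀ a, e (p a) = f a := by
  obtain ⟨e, he⟩ := LinearMap.exists_extend
    ((ker p).liftQ f h ∘ₗ p.quotKerEquivRange.symm.toLinearMap)
  refine ⟨e, fun a => ?_⟩
  have h1 := LinearMap.congr_fun he ⟨p a, LinearMap.mem_range_self p a⟩
  have h2 : p.quotKerEquivRange.symm ⟨p a, LinearMap.mem_range_self p a⟩
      = (ker p).mkQ a := by
    rw [LinearEquiv.symm_apply_eq]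
    rfl
  simpa [h2] using h1

/-- Two embeddings of a space into spaces of the same finite dimension differ by an
isomorphism of the ambient spaces. -/
theorem exists_linearEquiv_extend [FiniteDimensional k V] [FiniteDimensional k W]
    (ι : A →ₗ[k] V) (g : A →ₗ[k] W) (hι : Function.Injective ι) (hg : Function.Injective g)
    (hd : finrank k V = finrank k W) : ∃ e : V ≃ₗ[k] W, ∀ a, e (ι a) = g a := by
  let σ : V ≃ₗ[k] W := LinearEquiv.ofFinrankEq V W hd
  have hg' : Function.Injective (σ.symm.toLinearMap ∘ₗ g) := σ.symm.injective.comp hg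
  obtain ⟨e, he⟩ := Submodule.exists_linearEquiv_restrict_eq
    ((LinearEquiv.ofInjective ι hι).symm ≪≫ₗ LinearEquiv.ofInjective _ hg')
  refine ⟨e ≪≫ₗ σ, fun a => ?_⟩
  have h1 := he (LinearEquiv.ofInjective ι hι a)
  simp only [LinearEquiv.trans_apply, LinearEquiv.symm_apply_apply,
    LinearEquiv.ofInjective_apply, LinearMap.comp_apply, LinearEquiv.coe_coe] at h1
  simp [← h1]

/-- Extension of an isomorphism of subspaces to an isomorphism over `U`, for two maps to `U`
with the same image. -/
theorem exists_linearEquiv_extend_over [FiniteDimensional k V] [FiniteDimensional k W]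
    (ι : A →ₗ[k] V) (g : A →ₗ[k] W) (hι : Function.Injective ι) (hg : Function.Injective g)
    (hd : finrank k V = finrank k W) (φ : V →ₗ[k] U) (ψ : W →ₗ[k] U)
    (hr : range φ = range ψ) (hc : ∀ a, ψ (g a) = φ (ι a)) :
    ∃ e : V ≃ₗ[k] W, (∀ a, e (ι a) = g a) ∧ ∀ x, ψ (e x) = φ x := by
  have hker : finrank k (ker φ) = finrank k (ker ψ) := by
    have h1 := φ.finrank_range_add_finrank_ker
    have h2 := ψ.finrank_range_add_finrank_ker
    rw [hr] at h1
    omega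
  obtain ⟨h, hh⟩ := exists_linearEquiv_extend
    (A := ker (φ ∘ₗ ι)) (V := ker φ) (W := ker ψ)
    ((ι ∘ₗ (ker (φ ∘ₗ ι)).subtype).codRestrict _ fun a => a.2)
    ((g ∘ₗ (ker (φ ∘ₗ ι)).subtype).codRestrict _ fun a => (hc a).trans a.2)
    (fun a b hab => Subtype.ext (hι (congrArg Subtype.val hab)))
    (fun a b hab => Subtype.ext (hg (congrArg Subtype.val hab))) hker
  let p : (A × ker φ) →ₗ[k] V := ι.coprod (ker φ).subtype
  obtain ⟨e, he⟩ := exists_factor_of_ker_le_ker p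
    (g.coprod ((ker ψ).subtype ∘ₗ h.toLinearMap)) (by
      rintro ⟨a, x⟩ hax
      have hax' : ι a + (x : V) = 0 := hax
      have hx : (x : V) = -ι a := by rw [eq_neg_iff_add_eq_zero, add_comm, hax']
      have ha : a ∈ ker (φ ∘ₗ ι) := by
        have := x.2
        rw [hx] at this
        simpa using this
      have h1 := hh ⟨a, ha⟩
      have h2 : x = -(((ι ∘ₗ (ker (φ ∘ₗ ι)).subtype).codRestrict (ker φ) fun a => a.2)
        ⟨a, ha⟩) := Subtype.ext hx
      change g a + (h x : W) = 0
      rw [h2, map_neg, h1]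
      exact add_neg_cancel (g a))
  obtain ⟨c, hcc⟩ := exists_factor_of_ker_le_ker (range p).mkQ
    ((φ - ψ ∘ₗ e).codRestrict (range ψ) fun x =>
      sub_mem (hr ▸ LinearMap.mem_range_self φ x) (LinearMap.mem_range_self ψ _)) (by
      rw [Submodule.ker_mkQ]
      rintro _ ⟨⟨a, x⟩, rfl⟩
      refine Subtype.ext ?_
      have h1 : ψ (h x) = 0 := (h x).2
      have h2 : φ x = 0 := x.2
      have h3 : e (p (a, x)) = g a + h x := he _
      have h4 : p (a, x) = ι a + x := rfl
      change φ (p (a, x)) - ψ (e (p (a, x))) = 0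
      rw [h3, h4, map_add, map_add, hc, h1, h2, sub_self])
  obtain ⟨c', hc'⟩ := Module.projective_lifting_property ψ.rangeRestrict c
    ψ.surjective_rangeRestrict
  let e' : V →ₗ[k] W := e + c' ∘ₗ (range p).mkQ
  have hp : ∀ y, e' (p y) = e (p y) := fun y => by
    have : (range p).mkQ (p y) = 0 := by simp
    simp only [e', LinearMap.add_apply, LinearMap.comp_apply, this, map_zero, add_zero]
  have hcomm : ∀ x, ψ (e' x) = φ x := fun x => by
    have h1 : ψ (c' ((range p).mkQ x)) = c ((range p).mkQ x) :=
      congrArg Subtype.val (LinearMap.congr_fun hc' ((range p).mkQ x))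
    have h2 : (c ((range p).mkQ x) : U) = φ x - ψ (e x) := congrArg Subtype.val (hcc x)
    simp only [e', LinearMap.add_apply, LinearMap.comp_apply, map_add]
    rw [h1, h2]
    abel
  have hinj : Function.Injective e' := by
    rw [injective_iff_map_eq_zero]
    intro x hx
    have hx' : x ∈ ker φ := by
      rw [LinearMap.mem_ker, ← hcomm, hx, map_zero]
    have h1 := (hp (0, ⟨x, hx'⟩)).trans (he _)
    simp only [p, LinearMap.coprod_apply, map_zero, zero_add, Submodule.subtype_apply, hx,
      LinearMap.comp_apply, LinearEquiv.coe_coe] at h1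
    have h2 : h ⟨x, hx'⟩ = 0 := Subtype.ext h1.symm
    simpa using h2
  refine ⟨e'.linearEquivOfInjective hinj hd, fun a => ?_, fun x => hcomm x⟩
  have h1 := (hp (a, 0)).trans (he _)
  simpa [p] using h1

/-- Two finite-dimensional spaces over `U` carrying chains of subspaces with equal dimensions
and equal images in `U` are isomorphic over `U`, compatibly with the chains. -/
theorem exists_linearEquiv_map_flag_over [FiniteDimensional k V] [FiniteDimensional k W]
    (F : ℕ → Submodule k V) (E : ℕ → Submodule k W) (hF : Monotone F) (hE : Monotone E)
    (hd : ∀ s, finrank k (F s) = finrank k (E s)) (φ : V →ₗ[k] U) (ψ : W →ₗ[k] U)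
    (hr : ∀ s, (F s).map φ = (E s).map ψ) (m : ℕ) (hFm : F m = ⊤) (hEm : E m = ⊤) :
    ∃ e : V ≃ₗ[k] W, (∀ x, ψ (e x) = φ x) ∧
      ∀ s ≤ m, (F s).map e.toLinearMap = E s := by
  have key : ∀ s, ∃ e : F s ≃ₗ[k] E s, (∀ x, ψ (e x) = φ x) ∧
      ∀ r ≤ s, ∀ x : F s, (x : V) ∈ F r → (e x : W) ∈ E r := by
    have hr' : ∀ s, range (φ.domRestrict (F s)) = range (ψ.domRestrict (E s)) := fun s => by
      rw [LinearMap.range_domRestrict, LinearMap.range_domRestrict, hr]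
    intro s
    induction s with
    | zero =>
      obtain ⟨e, -, he⟩ := exists_linearEquiv_extend_over (A := (⊥ : Submodule k V)) 0 0
        (Function.injective_of_subsingleton _) (Function.injective_of_subsingleton _)
        (hd 0) _ _ (hr' 0) (by simp)
      refine ⟨e, he, fun r hr0 x _ => ?_⟩
      rw [Nat.le_zero.mp hr0]
      exact (e x).2
    | succ s ih =>
      obtain ⟨e, he, hes⟩ := ih
      obtain ⟨e', hext, he'⟩ := exists_linearEquiv_extend_over
        (Submodule.inclusion (hF s.le_succ))
        (Submodule.inclusion (hE s.le_succ) ∘ₗ e.toLinearMap)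
        (Submodule.inclusion_injective _)
        ((Submodule.inclusion_injective (hE s.le_succ)).comp e.injective)
        (hd (s + 1)) _ _ (hr' (s + 1)) (fun a => he a)
      refine ⟨e', he', fun r hrs x hx => ?_⟩
      rcases Nat.le_succ_iff.mp hrs with hrs | rfl
      · have h1 := congrArg Subtype.val (hext ⟨x, hF hrs hx⟩)
        have h2 := hes r hrs ⟨x, hF hrs hx⟩ hx
        exact h1.symm ▸ h2
      · exact (e' x).2
  obtain ⟨e, he, hes⟩ := key m
  refine ⟨(LinearEquiv.ofTop _ hFm).symm ≪≫ₗ e ≪≫ₗ LinearEquiv.ofTop _ hEm,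
    fun x => he _, fun s hs => ?_⟩
  refine Submodule.eq_of_le_of_finrank_eq ?_ ?_
  · rintro _ ⟨x, hx, rfl⟩
    exact hes s hs _ hx
  · rw [LinearEquiv.finrank_map_eq, hd]

end Extension

section Flag

variable {k : Type*} [Field k] {V W : ℕ → Type*}
  [∀ i, AddCommGroup (V i)] [∀ i, Module k (V i)]
  [∀ i, AddCommGroup (W i)] [∀ i, Module k (W i)]

/-- The subspace of `V m` generated from the vertices `≤ s`: the image of `V s` if `s ≤ m`, and
all of `V m` otherwise. -/
def imageFlag (φ : ∀ i : ℕ, V i →ₗ[k] V (i + 1)) : ∀ m : ℕ, ℕ → Submodule k (V m)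
  | 0, _ => ⊤
  | m + 1, s => if s ≤ m then (imageFlag φ m s).map (φ m) else ⊤

theorem imageFlag_eq_top (φ : ∀ i : ℕ, V i →ₗ[k] V (i + 1)) {m s : ℕ} (h : m ≤ s) :
    imageFlag φ m s = ⊤ := by
  cases m with
  | zero => rfl
  | succ m => exact if_neg (by omega)

theorem imageFlag_succ (φ : ∀ i : ℕ, V i →ₗ[k] V (i + 1)) {m s : ℕ} (h : s ≤ m) :
    imageFlag φ (m + 1) s = (imageFlag φ m s).map (φ m) :=
  if_pos h

theorem imageFlag_monotone (φ : ∀ i : ℕ, V i →ₗ[k] V (i + 1)) (m : ℕ) :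
    Monotone (imageFlag φ m) := by
  induction m with
  | zero => exact fun _ _ _ => le_rfl
  | succ m ih =>
    intro s t hst
    by_cases ht : t ≤ m
    · rw [imageFlag_succ φ ht, imageFlag_succ φ (hst.trans ht)]
      exact Submodule.map_mono (ih hst)
    · rw [imageFlag_eq_top φ (by omega : m + 1 ≤ t)]
      exact le_top

theorem imageFlag_add (φ : ∀ i : ℕ, V i →ₗ[k] V (i + 1)) (s t : ℕ) :
    imageFlag φ (s + t) s = range (comps φ s t) := by
  induction t with
  | zero => exact (imageFlag_eq_top φ le_rfl).trans LinearMap.range_id.symm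
  | succ t ih =>
    exact (imageFlag_succ φ (by omega : s ≤ s + t)).trans
      (by rw [ih, comps, LinearMap.range_comp])

theorem finrank_imageFlag_eq {φ : ∀ i : ℕ, V i →ₗ[k] V (i + 1)}
    {ψ : ∀ i : ℕ, W i →ₗ[k] W (i + 1)}
    (h : ∀ s t, finrank k (range (comps φ s t)) = finrank k (range (comps ψ s t)))
    (m s : ℕ) : finrank k (imageFlag φ m s) = finrank k (imageFlag ψ m s) := by
  rcases le_total s m with hs | hs
  · obtain ⟨t, rfl⟩ := Nat.exists_eq_add_of_le hs
    rw [imageFlag_add, imageFlag_add, h]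
  · rw [imageFlag_eq_top φ hs, imageFlag_eq_top ψ hs, ← imageFlag_eq_top φ (le_refl m),
      ← imageFlag_eq_top ψ (le_refl m)]
    exact (imageFlag_add φ m 0 ▸ imageFlag_add ψ m 0 ▸ h m 0 :)

/-- An isomorphism at vertex `m + 1` preserving the image flags lifts along the structure maps to
such an isomorphism at vertex `m`. -/
theorem exists_linearEquiv_lift_imageFlag [∀ i, FiniteDimensional k (V i)]
    [∀ i, FiniteDimensional k (W i)]
    {φ : ∀ i : ℕ, V i →ₗ[k] V (i + 1)} {ψ : ∀ i : ℕ, W i →ₗ[k] W (i + 1)}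
    (h : ∀ s t, finrank k (range (comps φ s t)) = finrank k (range (comps ψ s t)))
    (m : ℕ) (g : V (m + 1) ≃ₗ[k] W (m + 1))
    (hg : ∀ s, (imageFlag φ (m + 1) s).map g.toLinearMap = imageFlag ψ (m + 1) s) :
    ∃ e : V m ≃ₗ[k] W m, (∀ x, ψ m (e x) = g (φ m x)) ∧
      ∀ s, (imageFlag φ m s).map e.toLinearMap = imageFlag ψ m s := by
  have hle : ∀ s ≤ m, (imageFlag φ m s).map (g.toLinearMap ∘ₗ φ m)
      = (imageFlag ψ m s).map (ψ m) := fun s hs => by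
    rw [Submodule.map_comp, ← imageFlag_succ φ hs, hg, imageFlag_succ ψ hs]
  obtain ⟨e, he, hes⟩ := exists_linearEquiv_map_flag_over (imageFlag φ m) (imageFlag ψ m)
    (imageFlag_monotone φ m) (imageFlag_monotone ψ m) (finrank_imageFlag_eq h m)
    (g.toLinearMap ∘ₗ φ m) (ψ m) (fun s => by
      rcases le_total s m with hs | hs
      · exact hle s hs
      · rw [imageFlag_eq_top φ hs, imageFlag_eq_top ψ hs, ← imageFlag_eq_top φ (le_refl m),
          ← imageFlag_eq_top ψ (le_refl m)]
        exact hle m le_rfl)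
    m (imageFlag_eq_top φ le_rfl) (imageFlag_eq_top ψ le_rfl)
  refine ⟨e, he, fun s => ?_⟩
  rcases le_total s m with hs | hs
  · exact hes s hs
  · rw [imageFlag_eq_top φ hs, imageFlag_eq_top ψ hs, Submodule.map_top, LinearEquiv.range]

/-- A morphism of representations commutes with the composites of the structure maps. -/
theorem comps_comm {φ : ∀ i : ℕ, V i →ₗ[k] V (i + 1)} {ψ : ∀ i : ℕ, W i →ₗ[k] W (i + 1)}
    (g : ∀ i, V i →ₗ[k] W i) (hg : ∀ i x, ψ i (g i x) = g (i + 1) (φ i x)) (i t : ℕ) (x : V i) :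
    comps ψ i t (g i x) = g (i + t) (comps φ i t x) := by
  induction t with
  | zero => rfl
  | succ t ih =>
    change ψ (i + t) (comps ψ i t (g i x)) = _
    rw [ih, hg]
    rfl

/-- Isomorphic representations have structure maps whose composites have equal ranks. -/
theorem finrank_range_comps_eq {φ : ∀ i : ℕ, V i →ₗ[k] V (i + 1)}
    {ψ : ∀ i : ℕ, W i →ₗ[k] W (i + 1)} (g : ∀ i, V i ≃ₗ[k] W i)
    (hg : ∀ i x, ψ i (g i x) = g (i + 1) (φ i x)) (i t : ℕ) :
    finrank k (range (comps φ i t)) = finrank k (range (comps ψ i t)) := by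
  have h1 : comps ψ i t ∘ₗ (g i).toLinearMap = (g (i + t)).toLinearMap ∘ₗ comps φ i t :=
    LinearMap.ext fun x => comps_comm (fun i => (g i).toLinearMap) hg i t x
  have h2 : range (comps ψ i t) = (range (comps φ i t)).map (g (i + t)).toLinearMap := by
    rw [← LinearMap.range_comp, ← h1, LinearEquiv.range_comp]
  rw [h2, LinearEquiv.finrank_map_eq]

/-- Two representations having composites of equal ranks, one of them vanishing at the vertex `N`,
are isomorphic on the vertices `0, …, N`. -/
theorem exists_linearEquiv_of_finrank_range_comps_eq [∀ i, FiniteDimensional k (V i)]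
    [∀ i, FiniteDimensional k (W i)]
    {φ : ∀ i : ℕ, V i →ₗ[k] V (i + 1)} {ψ : ∀ i : ℕ, W i →ₗ[k] W (i + 1)}
    (h : ∀ s t, finrank k (range (comps φ s t)) = finrank k (range (comps ψ s t)))
    (N : ℕ) (hW : Subsingleton (W N)) :
    ∃ g : ∀ i, V i ≃ₗ[k] W i, ∀ i < N, ∀ x, ψ i (g i x) = g (i + 1) (φ i x) := by
  have hd : ∀ i, finrank k (V i) = finrank k (W i) := fun i => by
    have h1 := h i 0
    rwa [comps, comps, LinearMap.range_id, LinearMap.range_id, finrank_top, finrank_top] at h1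
  have key : ∃ g : ∀ i, V i ≃ₗ[k] W i,
      (∀ i, 0 ≤ i → i < N → ∀ x, ψ i (g i x) = g (i + 1) (φ i x)) ∧
        ∀ s, (imageFlag φ 0 s).map (g 0).toLinearMap = imageFlag ψ 0 s := by
    refine Nat.decreasingInduction (n := N) (motive := fun m _ => ∃ g : ∀ i, V i ≃ₗ[k] W i,
      (∀ i, m ≤ i → i < N → ∀ x, ψ i (g i x) = g (i + 1) (φ i x)) ∧
        ∀ s, (imageFlag φ m s).map (g m).toLinearMap = imageFlag ψ m s) ?_ ?_ N.zero_le
    · rintro m - ⟨g, hg, hgs⟩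
      obtain ⟨e, he, hes⟩ := exists_linearEquiv_lift_imageFlag h m (g (m + 1)) hgs
      refine ⟨Function.update g m e, fun i hi hiN x => ?_, ?_⟩
      · rw [Function.update_of_ne (by omega : i + 1 ≠ m)]
        rcases hi.eq_or_lt with rfl | hi
        · rw [Function.update_self, he]
        · rw [Function.update_of_ne (by omega : i ≠ m), hg i hi hiN]
      · rwa [Function.update_self]
    · exact ⟨fun i => LinearEquiv.ofFinrankEq _ _ (hd i), fun i hi hiN => by omega,
        fun s => Subsingleton.elim _ _⟩
  obtain ⟨g, hg, -⟩ := key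
  exact ⟨g, fun i hi => hg i i.zero_le hi⟩

end Flag

/-- Two representations `φ, ψ ∈ E(d)` of the equioriented quiver `Δ_n` lie in the
same `G_d`-orbit if and only if for all `1 ≤ i ≤ j ≤ n-1` one has
`rank(φ_j ∘ ⋯ ∘ φ_i) = rank(ψ_j ∘ ⋯ ∘ ψ_i)`.  (The dimension vector is padded
by zeros outside the vertex range `1, …, n`.) -/
theorem orbits_classified_by_ranks_type_A
    (k : Type*) [Field k] (n : ℕ) (hn : 1 ≤ n) (d : ℕ → ℕ)
    (hd0 : d 0 = 0) (hdn : ∀ j, n < j → d j = 0)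
    (φ ψ : ∀ i : ℕ, (Fin (d i) → k) →ₗ[k] (Fin (d (i + 1)) → k)) :
    sameOrbitA k d φ ψ ↔
      ∀ i j : ℕ, 1 ≤ i → i ≤ j → j ≤ n - 1 →
        finrank k (LinearMap.range (comps φ i (j - i + 1)))
          = finrank k (LinearMap.range (comps ψ i (j - i + 1))) := by
  constructor
  · rintro ⟨g, hg⟩ i j - - -
    exact finrank_range_comps_eq g (fun i x => by simp [hg i]) i _
  · intro h
    have hsub : ∀ i, d i = 0 → Subsingleton (Fin (d i) → k) := fun i hi => by
      rw [hi]
      infer_instance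
    have hall : ∀ s t, finrank k (range (comps φ s t)) = finrank k (range (comps ψ s t)) := by
      intro s t
      rcases Nat.eq_zero_or_pos t with rfl | ht
      · rfl
      rcases Nat.eq_zero_or_pos s with rfl | hs
      · have := hsub 0 hd0
        rw [Subsingleton.elim (comps φ 0 t) (comps ψ 0 t)]
      by_cases hst : s + t ≤ n
      · obtain ⟨u, rfl⟩ : ∃ u, t = u + 1 := ⟨t - 1, by omega⟩
        have := h s (s + u) hs (by omega) (by omega)
        rwa [Nat.add_sub_cancel_left] at this
      · have := hsub (s + t) (hdn _ (by omega))
        rw [Subsingleton.elim (comps φ s t) (comps ψ s t)]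
    obtain ⟨g, hg⟩ := exists_linearEquiv_of_finrank_range_comps_eq
      (V := fun i => Fin (d i) → k) (W := fun i => Fin (d i) → k) hall (n + 1)
      (hsub (n + 1) (hdn _ n.lt_succ_self))
    refine ⟨g, fun i => LinearMap.ext fun x => ?_⟩
    by_cases hi : i < n + 1
    · simp [← hg i hi]
    · have := hsub (i + 1) (hdn _ (by omega))
      exact Subsingleton.elim _ _
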